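/- Assume b_k > 0 for all k ≥ 0, and define g_0 = 0 and g_k = μ b_{k−1} / (κ c_k b_k) for k ≥ 1. Then (g_k)_{k≥0} converges, and lim_{k→∞} g_k = (1 − √(1 − 4μ/κ²)) / 2. -/

import Mathlib

/-- With the sequence `(B k)` as in the appendix lemma, assume `B k > 0` for all `k`,
and define `g 0 = 0`, `g k = μ B (k−1) / (κ c k B k)` for `k ≥ 1`.  Then `(g k)`
converges to `(1 − √(1 − 4μ/κ²)) / 2`. -/
theorem auxiliary_sequence_limit
    (q a b : ℝ) (hq0 : 0 < q) (hq1 : q < 1) (ha : 0 < a) (hb : 0 < b)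
    (c : ℕ → ℝ) (hc : ∀ k : ℕ, 1 ≤ k → c k = (Real.sqrt (1 - q ^ (2 * k)))⁻¹)
    (B : ℕ → ℝ) (hB0 : B 0 = 1) (hB1 : B 1 = (a + b) * c 1)
    (hBrec : ∀ k : ℕ, 1 ≤ k →
      B (k + 1) = (a + b) * c (k + 1) * B k - (a * b) * (c (k + 1) / c k) * B (k - 1))
    (hBpos : ∀ k : ℕ, 0 < B k)
    (g : ℕ → ℝ) (hg0 : g 0 = 0)
    (hg : ∀ k : ℕ, 1 ≤ k → g k = (a * b) * B (k - 1) / ((a + b) * c k * B k)) :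
    Filter.Tendsto g Filter.atTop
      (nhds ((1 - Real.sqrt (1 - 4 * (a * b) / (a + b) ^ 2)) / 2)) := by
  have hκ : 0 < a + b := by positivity
  obtain ⟨m, hm⟩ : ∃ m, m = a * b / (a + b) ^ 2 := ⟨_, rfl⟩
  have hm0 : 0 < m := by rw [hm]; positivity
  have hm4 : 0 ≤ 1 - 4 * m := by
    rw [hm]
    have : 1 - 4 * (a * b / (a + b) ^ 2) = (a - b) ^ 2 / (a + b) ^ 2 := by
      field_simp
      ring
    rw [this]; positivity
  have e4 : 4 * (a * b) / (a + b) ^ 2 = 4 * m := by rw [hm]; ring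
  rw [e4]
  obtain ⟨L, hL⟩ : ∃ L, L = (1 - Real.sqrt (1 - 4 * m)) / 2 := ⟨_, rfl⟩
  rw [← hL]
  have hs0 := Real.sqrt_nonneg (1 - 4 * m)
  have hs2 := Real.sq_sqrt hm4
  have hL2 : L ≤ 1 / 2 := by rw [hL]; linarith
  have hLm : L * (1 - L) = m := by rw [hL]; nlinarith
  have hLpos : 0 ≤ L := by
    by_contra h
    push Not at h
    nlinarith
  obtain ⟨d, hd⟩ : ∃ d : ℕ → ℝ, ∀ k, d k = 1 - q ^ (2 * k) := ⟨_, fun _ => rfl⟩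
  have hd1 : ∀ k, d k ≤ 1 := fun k => by
    rw [hd]; have : 0 < q ^ (2 * k) := by positivity
    linarith
  have hdpos : ∀ k, 1 ≤ k → 0 < d k := fun k hk => by
    rw [hd]
    have : q ^ (2 * k) < 1 := pow_lt_one₀ hq0.le hq1 (by omega)
    linarith
  have hd0 : ∀ k, 0 ≤ d k := fun k => by
    rw [hd]
    have : q ^ (2 * k) ≤ 1 := pow_le_one₀ hq0.le hq1.le
    linarith
  have hdmono : ∀ k, d k ≤ d (k + 1) := fun k => by
    rw [hd, hd]
    have : q ^ (2 * (k + 1)) ≤ q ^ (2 * k) :=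
      pow_le_pow_of_le_one hq0.le hq1.le (by omega)
    linarith
  have hcpos : ∀ k, 1 ≤ k → 0 < c k := fun k hk => by
    have := hdpos k hk
    rw [hc k hk, ← hd]; positivity
  have hcd : ∀ k, 1 ≤ k → c k ^ 2 * d k = 1 := fun k hk => by
    have := hdpos k hk
    rw [hc k hk, ← hd, inv_pow, Real.sq_sqrt this.le]
    exact inv_mul_cancel₀ this.ne'
  have hB : ∀ k, B (k + 1) = (a + b) * c (k + 1) * B k * (1 - g k) := by
    intro k
    rcases Nat.eq_zero_or_pos k with rfl | hk
    · rw [hg0, hB0, hB1]; ring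
    · rw [hBrec k hk, hg k hk]
      have := hcpos k hk
      have := hBpos k
      field_simp
  have hrec : ∀ k, g (k + 1) * (1 - g k) = m * d (k + 1) := by
    intro k
    have h1 := hcpos (k + 1) (by omega)
    have h2 := hBpos (k + 1)
    have h3 := hBpos k
    have h4 := hcd (k + 1) (by omega)
    have h5 : d (k + 1) = 1 / c (k + 1) ^ 2 := by
      rw [eq_div_iff (by positivity)]; linarith
    have h6 : 1 - g k = B (k + 1) / ((a + b) * c (k + 1) * B k) := by
      rw [eq_div_iff (by positivity), hB k]; ring
    rw [h6, hg (k + 1) (by omega), h5, hm, Nat.add_sub_cancel]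
    field_simp
  have hgL : ∀ k, g k ≤ L := by
    intro k
    induction k with
    | zero => rw [hg0]; exact hLpos
    | succ k ih =>
      have h1 := hrec k
      have h2 := hd1 (k + 1)
      by_contra h
      push Not at h
      nlinarith
  have hstep : ∀ k, g k ≤ g (k + 1) := by
    intro k
    induction k with
    | zero =>
      have h1 := hrec 0
      have h2 := hd0 (0 + 1)
      rw [hg0] at h1 ⊢
      nlinarith
    | succ k ih =>
      have h1 := hrec k
      have h2 := hrec (k + 1)
      have h3 := hdmono (k + 1)
      have h4 := hgL k
      have h5 := hgL (k + 1)
      have h6 : 0 ≤ g (k + 1) := by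
        have := hd0 (k + 1)
        by_contra h
        push Not at h
        nlinarith
      by_contra h
      push Not at h
      nlinarith
  have hmono : Monotone g := monotone_nat_of_le_succ hstep
  have hlim := tendsto_atTop_ciSup hmono ⟨L, by rintro _ ⟨k, rfl⟩; exact hgL k⟩
  obtain ⟨l, hl⟩ : ∃ l, l = ⨆ i, g i := ⟨_, rfl⟩
  rw [← hl] at hlim
  have hlL : l ≤ L := le_of_tendsto' hlim hgL
  have hdlim : Filter.Tendsto d Filter.atTop (nhds 1) := by
    have h1 : Filter.Tendsto (fun k : ℕ => (q ^ 2) ^ k) Filter.atTop (nhds 0) :=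
      tendsto_pow_atTop_nhds_zero_of_lt_one (by positivity)
        (pow_lt_one₀ hq0.le hq1 (by norm_num))
    have h2 := h1.const_sub 1
    rw [sub_zero] at h2
    refine h2.congr fun k => ?_
    rw [hd, pow_mul]
  have e1 := (hlim.comp (Filter.tendsto_add_atTop_nat 1)).mul (hlim.const_sub 1)
  have e2 := (hdlim.comp (Filter.tendsto_add_atTop_nat 1)).const_mul m
  have e3 : l * (1 - l) = m * 1 :=
    tendsto_nhds_unique e1 (e2.congr fun k => (hrec k).symm)
  have hfin : l = L := by
    have : (l - L) * (1 - l - L) = 0 := by nlinarith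
    rcases mul_eq_zero.mp this with h | h <;> linarith
  rwa [hfin] at hlim
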